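/- arXiv:math/0507027 — 2 statements merged into one kernel-verified Lean document; each statement's English description precedes it below -/
import Mathlib

section
/- Let m ≥ 1 and let W₁, …, W_m and V₁, …, V_m be subsets of a set X with W_i ⊆ V_i for every i, and let n₁, …, n_m be natural numbers. Assume that for all indices i, j ∈ {1, …, m}: if W_i ∩ W_j ≠ ∅ and n_i ≥ n_j, then W_i ⊆ V_j. Then there exists a subset U ⊆ {1, …, m} such that the sets W_u, u ∈ U, are pairwise disjoint and ⋃_{i=1}^{m} W_i ⊆ ⋃_{u∈U} V_u. -/
/-- Greedy selection in a finite family of sets: there is a disjoint subfamily such that every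
nonempty member meets a selected one whose weight is no larger. -/
theorem Finset.exists_pairwiseDisjoint_forall_inter_nonempty_le {ι X α : Type*} [LinearOrder α]
    (W : ι → Set X) (n : ι → α) (t : Finset ι) :
    ∃ U ⊆ t, (U : Set ι).PairwiseDisjoint W ∧
      ∀ i ∈ t, (W i).Nonempty → ∃ u ∈ U, (W i ∩ W u).Nonempty ∧ n u ≤ n i := by
  classical
  induction t using Finset.induction_on_max_value n with
  | empty => exact ⟨∅, by simp⟩
  | insert a s _ hmax ih =>
    obtain ⟨U, hUs, hU, hcov⟩ := ih
    by_cases hmeet : ∃ u ∈ U, (W a ∩ W u).Nonempty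
    · obtain ⟨u, hu, hau⟩ := hmeet
      refine ⟨U, hUs.trans (Finset.subset_insert a s), hU, fun i hi hne => ?_⟩
      rcases Finset.mem_insert.1 hi with rfl | hi
      · exact ⟨u, hu, hau, hmax u (hUs hu)⟩
      · exact hcov i hi hne
    · refine ⟨insert a U, Finset.insert_subset_insert a hUs, ?_, fun i hi hne => ?_⟩
      · rw [Finset.coe_insert]
        refine hU.insert fun u hu _ => ?_
        by_contra hdisj
        exact hmeet ⟨u, hu, Set.not_disjoint_iff_nonempty_inter.1 hdisj⟩
      · rcases Finset.mem_insert.1 hi with rfl | hi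
        · exact ⟨i, Finset.mem_insert_self i U, by simpa using hne, le_rfl⟩
        · obtain ⟨u, hu, hiu⟩ := hcov i hi hne
          exact ⟨u, Finset.mem_insert_of_mem hu, hiu⟩


/-- **Vitali-type selection.** Given `W i ⊆ V i` (`i = 1, …, m`) and natural numbers
`n i` such that whenever `W i ∩ W j ≠ ∅` and `n i ≥ n j` one has `W i ⊆ V j`,
there is a subfamily `U` with the `W u`, `u ∈ U`, pairwise disjoint and
`⋃ i W i ⊆ ⋃_{u ∈ U} V u`. -/
theorem vitali_type_selection {X : Type*} (m : ℕ) (hm : 1 ≤ m)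
    (W V : Fin m → Set X) (hWV : ∀ i, W i ⊆ V i) (n : Fin m → ℕ)
    (h : ∀ i j, (W i ∩ W j).Nonempty → n j ≤ n i → W i ⊆ V j) :
    ∃ U : Finset (Fin m),
      (↑U : Set (Fin m)).PairwiseDisjoint W ∧
      (⋃ i, W i) ⊆ ⋃ u ∈ U, V u := by
  obtain ⟨U, -, hU, hcov⟩ :=
    Finset.univ.exists_pairwiseDisjoint_forall_inter_nonempty_le W n
  refine ⟨U, hU, Set.iUnion_subset fun i x hx => ?_⟩
  obtain ⟨u, hu, hiu, hle⟩ := hcov i (Finset.mem_univ i) ⟨x, hx⟩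
  exact Set.mem_biUnion hu (h i u hiu hle hx)
end

section
/- Let μ be a measure on a measurable space X, let ε > 0 and γ ∈ (0, 1], and let K ⊆ A be measurable sets with 0 < μ(K) < ∞ and μ(A \ K) < ε·μ(K). Let U be a nonempty finite index set with measurable sets W_u ⊆ V_u ⊆ A for u ∈ U such that the W_u, u ∈ U, are pairwise disjoint, 0 < μ(W_u) and μ(W_u) ≥ γ·μ(V_u) for every u ∈ U, and K ⊆ ⋃_{u∈U} V_u. Then there exists u ∈ U such that μ(W_u \ K) < (ε/γ)·μ(W_u), i.e. the relative measure of the complement of K in W_u is less than ε/γ. -/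
open MeasureTheory

/-- If `K ⊆ A` with `0 < μ K < ∞` and `μ (A \ K) < ε * μ K`, and `K` is covered by
pairwise disjoint sets `W u ⊆ V u ⊆ A` of positive measure with
`μ (W u) ≥ γ * μ (V u)`, then some `W u` satisfies `μ (W u \ K) < (ε/γ) * μ (W u)`. -/
theorem exists_high_density_element {X : Type*} [MeasurableSpace X] (μ : Measure X)
    (ε γ : ℝ) (hε : 0 < ε) (hγ0 : 0 < γ) (hγ1 : γ ≤ 1)
    (K A : Set X) (hKA : K ⊆ A) (hKm : MeasurableSet K) (hAm : MeasurableSet A)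
    (hK0 : 0 < μ K) (hKfin : μ K < ⊤)
    (hAK : μ (A \ K) < ENNReal.ofReal ε * μ K)
    {ι : Type*} (U : Finset ι) (hU : U.Nonempty) (W V : ι → Set X)
    (hWm : ∀ u ∈ U, MeasurableSet (W u)) (hVm : ∀ u ∈ U, MeasurableSet (V u))
    (hWV : ∀ u ∈ U, W u ⊆ V u) (hVA : ∀ u ∈ U, V u ⊆ A)
    (hdisj : (↑U : Set ι).PairwiseDisjoint W)
    (hW0 : ∀ u ∈ U, 0 < μ (W u))
    (hγWV : ∀ u ∈ U, ENNReal.ofReal γ * μ (V u) ≤ μ (W u))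
    (hcover : K ⊆ ⋃ u ∈ U, V u) :
    ∃ u ∈ U, μ (W u \ K) < ENNReal.ofReal (ε / γ) * μ (W u) := by
  by_contra! h
  have hsum : ENNReal.ofReal ε * μ K ≤ μ (A \ K) :=
    calc ENNReal.ofReal ε * μ K
        ≤ ENNReal.ofReal ε * ∑ u ∈ U, μ (V u) := by
          gcongr
          exact (measure_mono hcover).trans (measure_biUnion_finset_le U V)
      _ = ∑ u ∈ U, ENNReal.ofReal (ε / γ) * (ENNReal.ofReal γ * μ (V u)) := by
          rw [Finset.mul_sum]
          refine Finset.sum_congr rfl fun u _ => ?_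
          rw [← mul_assoc, ← ENNReal.ofReal_mul (by positivity), div_mul_cancel₀ _ hγ0.ne']
      _ ≤ ∑ u ∈ U, μ (W u \ K) := Finset.sum_le_sum fun u hu =>
          (mul_le_mul_right (hγWV u hu) _).trans (h u hu)
      _ = μ (⋃ u ∈ U, W u \ K) :=
          (measure_biUnion_finset (hdisj.mono fun _ => Set.sdiff_subset)
            fun u hu => (hWm u hu).diff hKm).symm
      _ ≤ μ (A \ K) := measure_mono <| Set.iUnion₂_subset fun u hu =>
          Set.sdiff_subset_sdiff_left ((hWV u hu).trans (hVA u hu))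
  exact hsum.not_gt hAK
end
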